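/- arXiv:2304.10968 — 3 statements merged into one kernel-verified Lean document; each statement's English description precedes it below -/
import Mathlib

section
/- Let V be a real vector space equipped with a seminorm |·|, let Q ⊆ V be a linear subspace, and let I : V → V be a linear map with I q = q for every q ∈ Q. Let S : V → ℝ and let 0 < α_* ≤ α^* be constants such that (i) α_* |I w|² ≤ S(I w) for every w ∈ V, (ii) S(w) ≤ α^* |w|² for every w ∈ V, and (iii) S(I w) = S(w) for every w ∈ V. Then for every v ∈ V and every q ∈ Q one has |v − I v| ≤ (1 + √(α^*/α_*)) |v − q|; in particular the interpolation error |v − I v| is bounded by (1 + √(α^*/α_*)) times the best approximation error inf_{q ∈ Q} |v − q|. -/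
/-- abstract interpolation estimate from stability bounds.
`V` is a real vector space with a seminorm `n`, `Q` a subspace, `I` a linear
map reproducing `Q`, `S` a stabilization with stability constants
`0 < αs ≤ αt` and `S (I w) = S w`.  Then the interpolation error is bounded by
`(1 + √(αt/αs))` times the best approximation error from `Q`. -/
theorem stmt_0 {V : Type*} [AddCommGroup V] [Module ℝ V]
    (n : Seminorm ℝ V) (Q : Submodule ℝ V) (I : V →ₗ[ℝ] V)
    (hIQ : ∀ q ∈ Q, I q = q)
    (S : V → ℝ) (αs αt : ℝ) (hαs : 0 < αs) (hαst : αs ≤ αt)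
    (hlow : ∀ w : V, αs * (n (I w)) ^ 2 ≤ S (I w))
    (hup : ∀ w : V, S w ≤ αt * (n w) ^ 2)
    (hinv : ∀ w : V, S (I w) = S w) :
    ∀ v : V, ∀ q ∈ Q, n (v - I v) ≤ (1 + Real.sqrt (αt / αs)) * n (v - q) := by
  intro v q hq
  have hI : n (I (v - q)) ≤ Real.sqrt (αt / αs) * n (v - q) := by
    have h1 : αs * (n (I (v - q))) ^ 2 ≤ αt * (n (v - q)) ^ 2 :=
      (hlow _).trans ((hinv _).le.trans (hup _))
    have hpos : 0 ≤ αt / αs := div_nonneg (hαs.le.trans hαst) hαs.le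
    have h2 : (n (I (v - q))) ^ 2 ≤ αt / αs * (n (v - q)) ^ 2 := by
      rw [div_mul_eq_mul_div, le_div_iff₀ hαs]
      linarith
    refine (pow_le_pow_iff_left₀ (apply_nonneg n _) ?_ two_ne_zero).1 ?_
    · exact (mul_nonneg (Real.sqrt_nonneg _) (apply_nonneg n _))
    · rw [mul_pow, Real.sq_sqrt hpos]
      exact h2
  have hdec : v - I v = (v - q) - I (v - q) := by
    rw [map_sub, hIQ q hq]
    abel
  calc n (v - I v) = n ((v - q) - I (v - q)) := by rw [← hdec]
    _ ≤ n (v - q) + n (I (v - q)) := map_sub_le_add n _ _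
    _ ≤ (1 + Real.sqrt (αt / αs)) * n (v - q) := by linarith
end

section
/- For every natural number k there exists a constant C > 0, depending only on k, such that the following holds: for every h > 0 and every function v : ℝ² → ℝ that is twice continuously differentiable on a neighborhood of the closed square [0,h]² and whose Laplacian Δv = ∂²v/∂x² + ∂²v/∂y² coincides on (0,h)² with a bivariate polynomial of total degree ≤ k, one has (∫_{(0,h)²} (Δv)² dx dy)^{1/2} ≤ C h⁻¹ (∫_{(0,h)²} |∇v|² dx dy)^{1/2}. -/
open MeasureTheory

/-- Laplacian of a function of two real variables. -/
noncomputable def lap2 (v : ℝ × ℝ → ℝ) (p : ℝ × ℝ) : ℝ :=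
  iteratedDeriv 2 (fun x => v (x, p.2)) p.1 + iteratedDeriv 2 (fun y => v (p.1, y)) p.2

/-- Squared Euclidean norm of the gradient of a function of two real variables. -/
noncomputable def gradSq2 (v : ℝ × ℝ → ℝ) (p : ℝ × ℝ) : ℝ :=
  (deriv (fun x => v (x, p.2)) p.1) ^ 2 + (deriv (fun y => v (p.1, y)) p.2) ^ 2


/-- Exponents of the monomials used. -/
noncomputable def expT (k : ℕ) : Finset (Fin 2 →₀ ℕ) :=
  Finset.Iic (Finsupp.equivFunOnFinite.symm (fun _ => k))

/-- Polynomial with given coefficients. -/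
noncomputable def polyQ {k : ℕ} (c : expT k → ℝ) (p : ℝ × ℝ) : ℝ :=
  ∑ d, c d * (p.1 ^ (d.1 0) * p.2 ^ (d.1 1))

/-- The bubble function of the unit square. -/
noncomputable def bub (p : ℝ × ℝ) : ℝ := p.1 * (1 - p.1) * (p.2 * (1 - p.2))

/-- Bubble times monomial. -/
noncomputable def bmon (d : Fin 2 →₀ ℕ) (p : ℝ × ℝ) : ℝ :=
  bub p * (p.1 ^ (d 0) * p.2 ^ (d 1))

/-- Derivative of bubble times polynomial. -/
noncomputable def dphi {k : ℕ} (c : expT k → ℝ) (p : ℝ × ℝ) : ℝ × ℝ →L[ℝ] ℝ :=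
  ∑ d, c d • fderiv ℝ (bmon d.1) p

lemma contDiff_bmon (d : Fin 2 →₀ ℕ) : ContDiff ℝ 1 (bmon d) := by
  unfold bmon bub
  fun_prop

lemma phi_eq {k : ℕ} (c : expT k → ℝ) (p : ℝ × ℝ) :
    bub p * polyQ c p = ∑ d, c d * bmon d.1 p := by
  unfold polyQ bmon
  rw [Finset.mul_sum]
  refine Finset.sum_congr rfl fun d _ => ?_
  ring

lemma hasFDerivAt_phi {k : ℕ} (c : expT k → ℝ) (p : ℝ × ℝ) :
    HasFDerivAt (fun p => bub p * polyQ c p) (dphi c p) p := by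
  simp_rw [phi_eq]
  unfold dphi
  refine HasFDerivAt.fun_sum fun d _ => ?_
  exact (((contDiff_bmon d.1).differentiable (by norm_num)) p).hasFDerivAt.const_mul (c d)

lemma continuous_dphi (k : ℕ) (w : ℝ × ℝ) :
    Continuous (fun z : (expT k → ℝ) × (ℝ × ℝ) => dphi z.1 z.2 w) := by
  unfold dphi
  simp only [FunLike.coe_sum, FunLike.coe_smul, Finset.sum_apply, Pi.smul_apply, smul_eq_mul]
  refine continuous_finsetSum _ fun d _ => ?_
  have h1 : Continuous (fun p => fderiv ℝ (bmon d.1) p w) :=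
    ((contDiff_bmon d.1).continuous_fderiv (by norm_num)).clm_apply continuous_const
  have h2 := h1.comp (continuous_snd : Continuous (Prod.snd : (expT k → ℝ) × (ℝ × ℝ) → _))
  exact ((continuous_apply d).comp continuous_fst).mul h2

lemma continuous_polyQ (k : ℕ) :
    Continuous (fun z : (expT k → ℝ) × (ℝ × ℝ) => polyQ z.1 z.2) := by
  unfold polyQ
  fun_prop

lemma continuous_bub : Continuous bub := by
  unfold bub
  fun_prop

lemma polyQ_smul {k : ℕ} (t : ℝ) (c : expT k → ℝ) (p) : polyQ (t • c) p = t * polyQ c p := by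
  unfold polyQ
  rw [Finset.mul_sum]
  refine Finset.sum_congr rfl fun d _ => ?_
  simp only [Pi.smul_apply, smul_eq_mul]
  ring

lemma dphi_smul {k : ℕ} (t : ℝ) (c : expT k → ℝ) (p) : dphi (t • c) p = t • dphi c p := by
  unfold dphi
  rw [Finset.smul_sum]
  refine Finset.sum_congr rfl fun d _ => ?_
  simp [mul_smul]

/-- Every polynomial of total degree at most `k` is a `polyQ`. -/
lemma exists_coeff {k : ℕ} (q : MvPolynomial (Fin 2) ℝ) (hq : q.totalDegree ≤ k) :
    ∀ p : ℝ × ℝ, MvPolynomial.eval ![p.1, p.2] q = polyQ (fun d : expT k => q.coeff d.1) p := by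
  intro p
  have hsub : q.support ⊆ expT k := by
    intro d hd
    have := MvPolynomial.le_totalDegree hd
    simp only [expT, Finset.mem_Iic]
    intro i
    simp only [Finsupp.equivFunOnFinite_symm_apply_apply]
    by_cases hi : i ∈ d.support
    · have h2 : d i ≤ d.sum fun _ e => e := Finset.single_le_sum (f := d) (fun _ _ => Nat.zero_le _) hi
      omega
    · simp at hi
      omega
  rw [MvPolynomial.eval_eq']
  unfold polyQ
  rw [Finset.sum_coe_sort (expT k) (fun d => q.coeff d * (p.1 ^ (d 0) * p.2 ^ (d 1)))]
  rw [Finset.sum_subset hsub]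
  · simp [Fin.prod_univ_two]
  · intro d _ hd
    simp [MvPolynomial.notMem_support_iff.1 hd]

lemma polyQ_eq_eval {k : ℕ} (c : expT k → ℝ) (x : Fin 2 → ℝ) :
    polyQ c (x 0, x 1) = MvPolynomial.eval x (∑ d : expT k, MvPolynomial.monomial d.1 (c d)) := by
  simp only [map_sum, MvPolynomial.eval_monomial, polyQ]
  refine Finset.sum_congr rfl fun d _ => ?_
  rw [Finsupp.prod_fintype _ _ (by simp)]
  simp [Fin.prod_univ_two]

lemma polyQ_zero {k : ℕ} (c : expT k → ℝ)
    (h : ∀ p ∈ Set.Ioo (0 : ℝ) 1 ×ˢ Set.Ioo (0 : ℝ) 1, polyQ c p = 0) : c = 0 := by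
  have h0 : (∑ d : expT k, MvPolynomial.monomial d.1 (c d)) = 0 := by
    apply MvPolynomial.funext_set (fun _ => Set.Ioo (0 : ℝ) 1)
    · intro i
      exact Set.Ioo_infinite (by norm_num)
    · intro x hx
      rw [← polyQ_eq_eval, map_zero]
      exact h _ ⟨hx 0 (Set.mem_univ _), hx 1 (Set.mem_univ _)⟩
  funext e
  have h1 := congrArg (MvPolynomial.coeff e.1) h0
  rw [MvPolynomial.coeff_sum] at h1
  simp only [MvPolynomial.coeff_monomial, MvPolynomial.coeff_zero] at h1
  rw [Finset.sum_eq_single e] at h1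
  · simpa using h1
  · intro d _ hd
    rw [if_neg]
    exact fun h => hd (Subtype.ext h)
  · simp

lemma quad_bound {E : Type*} [NormedAddCommGroup E] [NormedSpace ℝ E] [FiniteDimensional ℝ E]
    (F G : E → ℝ) (hF : Continuous F) (hG : Continuous G)
    (hF2 : ∀ (t : ℝ) x, F (t • x) = t ^ 2 * F x) (hG2 : ∀ (t : ℝ) x, G (t • x) = t ^ 2 * G x)
    (hpos : ∀ x, x ≠ 0 → 0 < F x) : ∃ C : ℝ, 0 < C ∧ ∀ x, G x ≤ C * F x := by
  have : ProperSpace E := FiniteDimensional.proper ℝ E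
  have hc : IsCompact (Metric.sphere (0 : E) 1) := isCompact_sphere 0 1
  have hne : ∀ x ∈ Metric.sphere (0 : E) 1, x ≠ 0 := by
    rintro x hx rfl
    simp at hx
  obtain ⟨M, hM⟩ := (hc.image_of_continuousOn (f := fun x => G x / F x)
    (hG.continuousOn.div hF.continuousOn fun x hx => (hpos x (hne x hx)).ne')).bddAbove
  refine ⟨max M 1, by positivity, fun x => ?_⟩
  by_cases hx : x = 0
  · have h1 := hF2 0 0
    have h2 := hG2 0 0
    simp at h1 h2
    simp [hx, h1, h2]
  · have hn : 0 < ‖x‖ := norm_pos_iff.2 hx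
    have hxe : x = ‖x‖ • (‖x‖⁻¹ • x) := by
      rw [smul_smul, mul_inv_cancel₀ hn.ne', one_smul]
    have hs : ‖x‖⁻¹ • x ∈ Metric.sphere (0 : E) 1 := by
      simp [norm_smul, hn.ne']
    have h1 : G (‖x‖⁻¹ • x) / F (‖x‖⁻¹ • x) ≤ max M 1 :=
      (hM ⟨_, hs, rfl⟩).trans (le_max_left _ _)
    rw [div_le_iff₀ (hpos _ (hne _ hs))] at h1
    rw [hxe, hF2, hG2]
    nlinarith [sq_nonneg ‖x‖]

lemma sq_ae : (Set.Ioo (0 : ℝ) 1 ×ˢ Set.Ioo (0 : ℝ) 1 : Set (ℝ × ℝ)) =ᵐ[volume]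
    Set.Icc ((0 : ℝ), (0 : ℝ)) (1, 1) := by
  rw [Set.Icc_prod_eq]
  exact Measure.set_prod_ae_eq Ioo_ae_eq_Icc Ioo_ae_eq_Icc

lemma bub_pos {p : ℝ × ℝ} (hp : p ∈ Set.Ioo (0 : ℝ) 1 ×ˢ Set.Ioo (0 : ℝ) 1) : 0 < bub p := by
  obtain ⟨⟨h1, h2⟩, h3, h4⟩ := hp
  unfold bub
  have := sub_pos.2 h2
  have := sub_pos.2 h4
  positivity

lemma poly_bound (k : ℕ) : ∃ C : ℝ, 0 < C ∧ ∀ c : expT k → ℝ,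
    (∫ p in Set.Icc ((0 : ℝ), (0 : ℝ)) (1, 1),
      (polyQ c p ^ 2 + ((dphi c p (1, 0)) ^ 2 + (dphi c p (0, 1)) ^ 2))) ≤
    C * ∫ p in Set.Icc ((0 : ℝ), (0 : ℝ)) (1, 1), bub p * polyQ c p ^ 2 := by
  have hFc : Continuous (fun z : (expT k → ℝ) × (ℝ × ℝ) => bub z.2 * polyQ z.1 z.2 ^ 2) :=
    (continuous_bub.comp continuous_snd).mul ((continuous_polyQ k).pow 2)
  apply quad_bound (fun c : expT k → ℝ =>
    ∫ p in Set.Icc ((0 : ℝ), (0 : ℝ)) (1, 1), bub p * polyQ c p ^ 2) (fun c : expT k → ℝ =>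
    ∫ p in Set.Icc ((0 : ℝ), (0 : ℝ)) (1, 1),
      (polyQ c p ^ 2 + ((dphi c p (1, 0)) ^ 2 + (dphi c p (0, 1)) ^ 2)))
  · exact continuous_parametric_integral_of_continuous
      (f := fun c p => bub p * polyQ c p ^ 2) hFc isCompact_Icc
  · apply continuous_parametric_integral_of_continuous
      (f := fun (c : expT k → ℝ) p =>
        (polyQ c p ^ 2 + ((dphi c p (1, 0)) ^ 2 + (dphi c p (0, 1)) ^ 2))) _ isCompact_Icc
    exact ((continuous_polyQ k).pow 2).add
      (((continuous_dphi k (1, 0)).pow 2).add ((continuous_dphi k (0, 1)).pow 2))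
  · intro t c
    rw [← integral_const_mul]
    congr 1
    funext p
    rw [polyQ_smul]
    ring
  · intro t c
    rw [← integral_const_mul]
    congr 1
    funext p
    rw [polyQ_smul, dphi_smul]
    simp only [FunLike.coe_smul, Pi.smul_apply, smul_eq_mul]
    ring
  · intro c hc
    obtain ⟨p, hp, hne⟩ : ∃ p ∈ Set.Ioo (0 : ℝ) 1 ×ˢ Set.Ioo (0 : ℝ) 1, polyQ c p ≠ 0 := by
      by_contra! hcon
      exact hc (polyQ_zero c hcon)
    have hcont : Continuous (fun p => bub p * polyQ c p ^ 2) :=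
      hFc.comp (Continuous.prodMk_right c)
    rw [← setIntegral_congr_set sq_ae]
    have hop : IsOpen (Set.Ioo (0 : ℝ) 1 ×ˢ Set.Ioo (0 : ℝ) 1) := isOpen_Ioo.prod isOpen_Ioo
    rw [setIntegral_pos_iff_support_of_nonneg_ae]
    · have ho : IsOpen (Function.support (fun p => bub p * polyQ c p ^ 2) ∩
          Set.Ioo (0 : ℝ) 1 ×ˢ Set.Ioo (0 : ℝ) 1) := hcont.isOpen_support.inter hop
      refine ho.measure_pos volume ⟨p, ?_, hp⟩
      have := bub_pos hp
      simp only [Function.mem_support]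
      positivity
    · filter_upwards [ae_restrict_mem hop.measurableSet] with x hx
      have := bub_pos hx
      simp only [Pi.zero_apply]
      positivity
    · exact IntegrableOn.congr_set_ae (hcont.continuousOn.integrableOn_compact isCompact_Icc) sq_ae

lemma deriv_slice1 {w : ℝ × ℝ → ℝ} {p : ℝ × ℝ} (h : DifferentiableAt ℝ w p) :
    deriv (fun x => w (x, p.2)) p.1 = fderiv ℝ w p (1, 0) := by
  have h1 : HasDerivAt (fun x : ℝ => (x, p.2)) ((1 : ℝ), (0 : ℝ)) p.1 :=
    (hasDerivAt_id p.1).prodMk (hasDerivAt_const p.1 p.2)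
  exact (HasFDerivAt.comp_hasDerivAt (f := fun x : ℝ => (x, p.2)) p.1 h.hasFDerivAt h1).deriv

lemma deriv_slice2 {w : ℝ × ℝ → ℝ} {p : ℝ × ℝ} (h : DifferentiableAt ℝ w p) :
    deriv (fun y => w (p.1, y)) p.2 = fderiv ℝ w p (0, 1) := by
  have h1 : HasDerivAt (fun y : ℝ => (p.1, y)) ((0 : ℝ), (1 : ℝ)) p.2 :=
    (hasDerivAt_const p.2 p.1).prodMk (hasDerivAt_id p.2)
  exact (HasFDerivAt.comp_hasDerivAt (f := fun y : ℝ => (p.1, y)) p.2 h.hasFDerivAt h1).deriv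

lemma lap2_eq {v : ℝ × ℝ → ℝ} {U : Set (ℝ × ℝ)} (hU : IsOpen U) (hv : ContDiffOn ℝ 2 v U)
    {p : ℝ × ℝ} (hp : p ∈ U) :
    lap2 v p = fderiv ℝ (fun z => fderiv ℝ v z (1, 0)) p (1, 0) +
      fderiv ℝ (fun z => fderiv ℝ v z (0, 1)) p (0, 1) := by
  have hd : ∀ z ∈ U, DifferentiableAt ℝ v z := fun z hz =>
    (hv.differentiableOn (by norm_num)).differentiableAt (hU.mem_nhds hz)
  have hf : ContDiffOn ℝ 1 (fderiv ℝ v) U := hv.fderiv_of_isOpen hU (by norm_num)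
  have hg : ∀ w, DifferentiableAt ℝ (fun z => fderiv ℝ v z w) p := fun w =>
    (((hf.differentiableOn (by norm_num)).differentiableAt (hU.mem_nhds hp))).clm_apply
      (differentiableAt_const w)
  unfold lap2
  rw [← deriv_slice1 (hg _), ← deriv_slice2 (hg _)]
  simp only [iteratedDeriv_succ, iteratedDeriv_zero]
  congr 1
  · apply Filter.EventuallyEq.deriv_eq
    have hc : Continuous (fun x : ℝ => (x, p.2)) := by fun_prop
    filter_upwards [(hU.preimage hc).mem_nhds (x := p.1) hp] with x hx
    exact deriv_slice1 (p := (x, p.2)) (hd _ hx)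
  · apply Filter.EventuallyEq.deriv_eq
    have hc : Continuous (fun y : ℝ => (p.1, y)) := by fun_prop
    filter_upwards [(hU.preimage hc).mem_nhds (x := p.2) hp] with y hy
    exact deriv_slice2 (p := (p.1, y)) (hd _ hy)

lemma unit_bound (k : ℕ) : ∃ C : ℝ, 0 < C ∧ ∀ v : ℝ × ℝ → ℝ,
      (∃ U : Set (ℝ × ℝ), IsOpen U ∧ Set.Icc ((0 : ℝ), (0 : ℝ)) (1, 1) ⊆ U ∧
        ContDiffOn ℝ 2 v U) →
      (∃ c : expT k → ℝ, ∀ p ∈ Set.Ioo (0 : ℝ) 1 ×ˢ Set.Ioo (0 : ℝ) 1, lap2 v p = polyQ c p) →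
      (∫ p in Set.Ioo (0 : ℝ) 1 ×ˢ Set.Ioo (0 : ℝ) 1, (lap2 v p) ^ 2) ≤
        C ^ 2 * (∫ p in Set.Ioo (0 : ℝ) 1 ×ˢ Set.Ioo (0 : ℝ) 1, gradSq2 v p) := by
  obtain ⟨C, hC, hb⟩ := poly_bound k
  refine ⟨C, hC, ?_⟩
  rintro v ⟨U, hU, hKU, hv⟩ ⟨c, hc⟩
  specialize hb c
  set S : Set (ℝ × ℝ) := Set.Ioo (0 : ℝ) 1 ×ˢ Set.Ioo (0 : ℝ) 1 with hS
  set K : Set (ℝ × ℝ) := Set.Icc ((0 : ℝ), (0 : ℝ)) (1, 1) with hK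
  have hSm : MeasurableSet S := measurableSet_Ioo.prod measurableSet_Ioo
  have hSK : S ⊆ K := by
    rw [hK, Set.Icc_prod_eq]
    exact Set.prod_mono Set.Ioo_subset_Icc_self Set.Ioo_subset_Icc_self
  have hae : S =ᵐ[volume] K := sq_ae
  have hd : ∀ z ∈ U, DifferentiableAt ℝ v z := fun z hz =>
    (hv.differentiableOn (by norm_num)).differentiableAt (hU.mem_nhds hz)
  have hf : ContDiffOn ℝ 1 (fderiv ℝ v) U := hv.fderiv_of_isOpen hU (by norm_num)
  have hgc : ∀ w, ContDiffOn ℝ 1 (fun z => fderiv ℝ v z w) U := fun w =>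
    hf.clm_apply contDiffOn_const
  have hgd : ∀ w, ∀ p ∈ U, DifferentiableAt ℝ (fun z => fderiv ℝ v z w) p := fun w p hp =>
    ((hgc w).differentiableOn (by norm_num)).differentiableAt (hU.mem_nhds hp)
  have hgcK : ∀ w, ContinuousOn (fun z => fderiv ℝ v z w) K := fun w =>
    ((hgc w).continuousOn).mono hKU
  have hg2K : ∀ w w', ContinuousOn (fun p => fderiv ℝ (fun z => fderiv ℝ v z w) p w') K :=
    fun w w' => (((hgc w).continuousOn_fderiv_of_isOpen hU (by norm_num)).mono hKU).clm_apply
      continuousOn_const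
  have hQc : Continuous (polyQ c) := (continuous_polyQ k).comp (Continuous.prodMk_right c)
  have hdc : ∀ w, Continuous (fun p => dphi c p w) := fun w =>
    (continuous_dphi k w).comp (Continuous.prodMk_right c)
  have hphi : Continuous (fun p => bub p * polyQ c p) := continuous_bub.mul hQc
  -- integrability on S
  have hcontInt : ∀ f : ℝ × ℝ → ℝ, ContinuousOn f K → IntegrableOn f S := fun f h =>
    (h.integrableOn_compact isCompact_Icc).mono_set hSK
  have hgrad : ∀ p ∈ S, gradSq2 v p = (fderiv ℝ v p (1, 0)) ^ 2 + (fderiv ℝ v p (0, 1)) ^ 2 := by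
    intro p hp
    unfold gradSq2
    rw [deriv_slice1 (hd _ (hKU (hSK hp))), deriv_slice2 (hd _ (hKU (hSK hp)))]
  have hlap : ∫ p in S, (lap2 v p) ^ 2 = ∫ p in S, polyQ c p ^ 2 :=
    setIntegral_congr_fun hSm fun p hp => by simp only [hc p hp]
  -- divergence theorem
  let f' : ℝ × ℝ → ℝ × ℝ → ℝ × ℝ →L[ℝ] ℝ := fun w p =>
    (bub p * polyQ c p) • fderiv ℝ (fun z => fderiv ℝ v z w) p + (fderiv ℝ v p w) • dphi c p
  have hf' : ∀ w, ∀ p ∈ U,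
      HasFDerivAt (fun p => (bub p * polyQ c p) * fderiv ℝ v p w) (f' w p) p := fun w p hp =>
    (hasFDerivAt_phi c p).mul (hgd w p hp).hasFDerivAt
  have hf'e : ∀ w w' p, f' w p w' = bub p * polyQ c p * fderiv ℝ (fun z => fderiv ℝ v z w) p w' +
      fderiv ℝ v p w * dphi c p w' := fun w w' p => by simp [f']
  have hf'c : ∀ w w', ContinuousOn (fun p => f' w p w') K := fun w w' => by
    simp only [hf'e]
    exact (hphi.continuousOn.mul (hg2K w w')).add ((hgcK w).mul (hdc w').continuousOn)
  have hdivc : ContinuousOn (fun p => f' (1, 0) p (1, 0) + f' (0, 1) p (0, 1)) K :=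
    (hf'c _ _).add (hf'c _ _)
  have hdiv : ∫ p in S, (f' (1, 0) p (1, 0) + f' (0, 1) p (0, 1)) = 0 := by
    rw [setIntegral_congr_set hae]
    rw [integral_divergence_prod_Icc_of_hasFDerivAt_of_le
      (fun p => (bub p * polyQ c p) * fderiv ℝ v p (1, 0))
      (fun p => (bub p * polyQ c p) * fderiv ℝ v p (0, 1))
      (f' (1, 0)) (f' (0, 1)) (0, 0) (1, 1) (by simp [Prod.le_def])
      (hphi.continuousOn.mul (hgcK _)) (hphi.continuousOn.mul (hgcK _))
      (fun p hp => hf' _ p (hKU (hSK hp))) (fun p hp => hf' _ p (hKU (hSK hp)))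
      (hdivc.integrableOn_compact isCompact_Icc)]
    simp [bub]
  have hgi : IntegrableOn (gradSq2 v) S :=
    (hcontInt _ (((hgcK (1, 0)).pow 2).add ((hgcK (0, 1)).pow 2))).congr_fun
      (fun p hp => (hgrad p hp).symm) hSm
  rw [← setIntegral_congr_set hae, ← setIntegral_congr_set hae] at hb
  have hQi : IntegrableOn (fun p => polyQ c p ^ 2) S := hcontInt _ (hQc.pow 2).continuousOn
  have hDi : IntegrableOn (fun p => (dphi c p (1, 0)) ^ 2 + (dphi c p (0, 1)) ^ 2) S :=
    hcontInt _ (((hdc _).pow 2).add ((hdc _).pow 2)).continuousOn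
  have hBi : IntegrableOn (fun p => bub p * polyQ c p ^ 2) S :=
    hcontInt _ (continuous_bub.mul (hQc.pow 2)).continuousOn
  rw [integral_add hQi hDi] at hb
  have hEi : IntegrableOn (fun p => (2 * C)⁻¹ * ((dphi c p (1, 0)) ^ 2 + (dphi c p (0, 1)) ^ 2) +
      C / 2 * gradSq2 v p) S := (hDi.const_mul _).add (hgi.const_mul _)
  have hmain : ∫ p in S, bub p * polyQ c p ^ 2 ≤
      ∫ p in S, ((f' (1, 0) p (1, 0) + f' (0, 1) p (0, 1)) +
        ((2 * C)⁻¹ * ((dphi c p (1, 0)) ^ 2 + (dphi c p (0, 1)) ^ 2) +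
          C / 2 * gradSq2 v p)) := by
    refine setIntegral_mono_on hBi ((hcontInt _ hdivc).add hEi) hSm fun p hp => ?_
    rw [hgrad p hp, hf'e, hf'e]
    have h1 := hc p hp
    rw [lap2_eq hU hv (hKU (hSK hp))] at h1
    have key : ∀ a b : ℝ, 0 ≤ a * b + ((2 * C)⁻¹ * b ^ 2 + C / 2 * a ^ 2) := by
      intro a b
      have : a * b + ((2 * C)⁻¹ * b ^ 2 + C / 2 * a ^ 2) = (2 * C)⁻¹ * (b + C * a) ^ 2 := by
        field_simp
        ring
      rw [this]
      positivity
    have k1 := key (fderiv ℝ v p (1, 0)) (dphi c p (1, 0))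
    have k2 := key (fderiv ℝ v p (0, 1)) (dphi c p (0, 1))
    have h2 : bub p * polyQ c p ^ 2 = bub p * polyQ c p *
      (fderiv ℝ (fun z => fderiv ℝ v z (1, 0)) p (1, 0) +
      fderiv ℝ (fun z => fderiv ℝ v z (0, 1)) p (0, 1)) := by
      rw [h1]
      ring
    rw [h2]
    linarith
  rw [integral_add (hcontInt _ hdivc) hEi, hdiv,
    integral_add (hDi.const_mul _) (hgi.const_mul _), integral_const_mul, integral_const_mul,
    zero_add] at hmain
  rw [hlap]
  have hQ0 : 0 ≤ ∫ p in S, polyQ c p ^ 2 := integral_nonneg fun p => sq_nonneg _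
  have hD0 : 0 ≤ ∫ p in S, ((dphi c p (1, 0)) ^ 2 + (dphi c p (0, 1)) ^ 2) :=
    integral_nonneg fun p => by positivity
  generalize (∫ p in S, polyQ c p ^ 2) = A at *
  generalize (∫ p in S, ((dphi c p (1, 0)) ^ 2 + (dphi c p (0, 1)) ^ 2)) = D at *
  generalize (∫ p in S, bub p * polyQ c p ^ 2) = B at *
  generalize (∫ p in S, gradSq2 v p) = G at *
  have h3 : (2 * C)⁻¹ * D ≤ (2 * C)⁻¹ * (C * B) := by
    apply mul_le_mul_of_nonneg_left _ (by positivity)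
    linarith
  have h4 : (2 * C)⁻¹ * (C * B) = B / 2 := by field_simp
  have h5 : B ≤ C * G := by linarith
  have h6 : C * B ≤ C * (C * G) := mul_le_mul_of_nonneg_left h5 hC.le
  nlinarith

lemma lap2_scale (h : ℝ) (v : ℝ × ℝ → ℝ) (p : ℝ × ℝ) :
    lap2 (fun z => v (h • z)) p = h ^ 2 * lap2 v (h • p) := by
  have key : ∀ (f : ℝ → ℝ) (x : ℝ), iteratedDeriv 2 (fun t => f (h * t)) x =
      h ^ 2 * iteratedDeriv 2 f (h * x) := by
    intro f x
    have h1 : ∀ g : ℝ → ℝ, deriv (fun t => g (h * t)) = fun t => h * deriv g (h * t) := by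
      intro g
      funext t
      exact deriv_comp_mul_left h g t
    simp only [iteratedDeriv_succ, iteratedDeriv_zero]
    rw [h1 f, deriv_const_mul_field, h1 (deriv f)]
    ring
  unfold lap2
  simp only [Prod.smul_mk, smul_eq_mul, Prod.smul_fst, Prod.smul_snd]
  rw [key (fun x => v (x, h * p.2)), key (fun y => v (h * p.1, y))]
  ring

lemma gradSq2_scale (h : ℝ) (v : ℝ × ℝ → ℝ) (p : ℝ × ℝ) :
    gradSq2 (fun z => v (h • z)) p = h ^ 2 * gradSq2 v (h • p) := by
  have h1 : ∀ (g : ℝ → ℝ) (t : ℝ), deriv (fun t => g (h * t)) t = h * deriv g (h * t) :=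
    fun g t => deriv_comp_mul_left h g t
  unfold gradSq2
  simp only [Prod.smul_mk, smul_eq_mul, Prod.smul_fst, Prod.smul_snd]
  rw [h1 (fun x => v (x, h * p.2)), h1 (fun y => v (h * p.1, y))]
  ring

open scoped Pointwise in
lemma smul_sq {h : ℝ} (hh : 0 < h) : h • (Set.Ioo (0 : ℝ) 1 ×ˢ Set.Ioo (0 : ℝ) 1) =
    Set.Ioo (0 : ℝ) h ×ˢ Set.Ioo (0 : ℝ) h := by
  ext p
  rw [Set.mem_smul_set_iff_inv_smul_mem₀ hh.ne']
  simp only [Set.mem_prod, Set.mem_Ioo, Prod.smul_fst, Prod.smul_snd, smul_eq_mul,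
    inv_mul_lt_one₀ hh, inv_pos, hh, mul_pos_iff_of_pos_left]

lemma integral_scale {h : ℝ} (hh : 0 < h) (f : ℝ × ℝ → ℝ) :
    ∫ p in Set.Ioo (0 : ℝ) 1 ×ˢ Set.Ioo (0 : ℝ) 1, f (h • p) =
    (h ^ 2)⁻¹ * ∫ p in Set.Ioo (0 : ℝ) h ×ˢ Set.Ioo (0 : ℝ) h, f p := by
  rw [Measure.setIntegral_comp_smul_of_pos volume f _ hh, smul_sq hh]
  simp


/-- inverse estimate `‖Δv‖_{0,K} ≤ C h⁻¹ |v|_{1,K}` on the square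
`K = (0,h)²` for functions whose Laplacian is a polynomial of total degree ≤ k. -/
theorem stmt_2 (k : ℕ) :
    ∃ C : ℝ, 0 < C ∧ ∀ h : ℝ, 0 < h → ∀ v : ℝ × ℝ → ℝ,
      (∃ U : Set (ℝ × ℝ), IsOpen U ∧ Set.Icc ((0 : ℝ), (0 : ℝ)) (h, h) ⊆ U ∧
        ContDiffOn ℝ 2 v U) →
      (∃ q : MvPolynomial (Fin 2) ℝ, q.totalDegree ≤ k ∧
        ∀ p ∈ Set.Ioo (0 : ℝ) h ×ˢ Set.Ioo (0 : ℝ) h,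
          lap2 v p = MvPolynomial.eval ![p.1, p.2] q) →
      Real.sqrt (∫ p in Set.Ioo (0 : ℝ) h ×ˢ Set.Ioo (0 : ℝ) h, (lap2 v p) ^ 2) ≤
        C * h⁻¹ * Real.sqrt (∫ p in Set.Ioo (0 : ℝ) h ×ˢ Set.Ioo (0 : ℝ) h, gradSq2 v p) := by
  obtain ⟨C, hC, hb⟩ := unit_bound k
  refine ⟨C, hC, ?_⟩
  rintro h hh v ⟨U, hU, hKU, hv⟩ ⟨q, hq, hqv⟩
  have hmem : ∀ p ∈ Set.Ioo (0 : ℝ) 1 ×ˢ Set.Ioo (0 : ℝ) 1,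
      h • p ∈ Set.Ioo (0 : ℝ) h ×ˢ Set.Ioo (0 : ℝ) h := fun p hp => by
    rw [← smul_sq hh]
    exact Set.smul_mem_smul_set hp
  have key := hb (fun z => v (h • z))
    ⟨(fun z => h • z) ⁻¹' U, hU.preimage (continuous_const_smul h), by
      intro p hp
      apply hKU
      obtain ⟨⟨h1, h2⟩, h3, h4⟩ := hp
      simp only at h1 h2 h3 h4
      refine ⟨⟨?_, ?_⟩, ?_, ?_⟩ <;> simp only [Prod.smul_fst, Prod.smul_snd, smul_eq_mul] <;>
        nlinarith, by
      refine hv.comp (f := fun z : ℝ × ℝ => h • z) ?_ fun z hz => hz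
      exact (contDiff_const_smul h).contDiffOn⟩
    ⟨fun d => h ^ 2 * (h ^ (d.1 0) * h ^ (d.1 1)) * q.coeff d.1, by
      intro p hp
      rw [lap2_scale, hqv _ (hmem p hp), exists_coeff q hq]
      unfold polyQ
      rw [Finset.mul_sum]
      refine Finset.sum_congr rfl fun d _ => ?_
      simp only [Prod.smul_fst, Prod.smul_snd, smul_eq_mul, mul_pow]
      ring⟩
  simp only [lap2_scale, gradSq2_scale] at key
  rw [integral_scale hh (fun p => (h ^ 2 * lap2 v p) ^ 2),
    integral_scale hh (fun p => h ^ 2 * gradSq2 v p)] at key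
  simp only [mul_pow] at key
  rw [integral_const_mul, integral_const_mul] at key
  apply Real.sqrt_le_iff.2
  have hG : 0 ≤ ∫ p in Set.Ioo (0 : ℝ) h ×ˢ Set.Ioo (0 : ℝ) h, gradSq2 v p :=
    integral_nonneg fun p => by
      unfold gradSq2
      positivity
  refine ⟨by positivity, ?_⟩
  rw [mul_pow, mul_pow, Real.sq_sqrt hG]
  generalize (∫ p in Set.Ioo (0 : ℝ) h ×ˢ Set.Ioo (0 : ℝ) h, gradSq2 v p) = G at *
  generalize (∫ p in Set.Ioo (0 : ℝ) h ×ˢ Set.Ioo (0 : ℝ) h, lap2 v p ^ 2) = L at *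
  have h1 : (h ^ 2)⁻¹ * ((h ^ 2) ^ 2 * L) = h ^ 2 * L := by field_simp
  have h2 : C ^ 2 * ((h ^ 2)⁻¹ * (h ^ 2 * G)) = C ^ 2 * G := by field_simp
  rw [h1, h2] at key
  have h3 : L = (h ^ 2)⁻¹ * (h ^ 2 * L) := by field_simp
  rw [h3]
  calc _ ≤ (h ^ 2)⁻¹ * (C ^ 2 * G) := by gcongr
    _ = _ := by
      rw [inv_pow]
      ring
end

section
/- For every natural number p ≥ 1 there exists a constant C > 0, depending only on p, such that for every function v : ℝ² → ℝ that is continuously differentiable on a neighborhood of the closed unit square [0,1]² and satisfies ∫_{(0,1)²} v dx dy = 0, the following holds with K = (0,1)². For each of the four edges e of K, let γ_e : [0,1] → ℝ² be the affine arclength parametrization of e, and let v̂_e be the unique univariate polynomial of degree ≤ p − 1 satisfying ∫₀¹ (v(γ_e(t)) − v̂_e(t)) t^j dt = 0 for every j = 0, …, p − 1. Let v̂ be the unique bivariate polynomial of total degree ≤ p − 2 satisfying ∫_K (v − v̂) m dx dy = 0 for every bivariate polynomial m of total degree ≤ p − 2 (with v̂ = 0 when p = 1). Then Σ_{e} ∫₀¹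 v̂_e(t)² dt + ∫_K v̂² dx dy ≤ C ∫_K |∇v|² dx dy, the sum running over the four edges of K. -/
open MeasureTheory

/-- The space of bivariate real polynomials of total degree at most `k`, for an
integer `k` (so that `k < 0` gives the zero space, e.g. `P₋₁ = {0}`). -/
def polyLE (k : ℤ) : Set (MvPolynomial (Fin 2) ℝ) :=
  {m | m = 0 ∨ (0 ≤ k ∧ (m.totalDegree : ℤ) ≤ k)}

/-- Evaluation of a bivariate polynomial at a point of `ℝ × ℝ`. -/
noncomputable def evP (q : MvPolynomial (Fin 2) ℝ) (z : ℝ × ℝ) : ℝ :=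
  MvPolynomial.eval ![z.1, z.2] q

/-- Affine arclength parametrizations of the four edges of the unit square. -/
noncomputable def edgeParam : Fin 4 → ℝ → ℝ × ℝ
  | 0 => fun t => (t, 0)
  | 1 => fun t => (1, t)
  | 2 => fun t => (t, 1)
  | 3 => fun t => (0, t)

lemma jensen01 (f : ℝ → ℝ) (hf : Continuous f) :
    (∫ t in (0:ℝ)..1, f t) ^ 2 ≤ ∫ t in (0:ℝ)..1, f t ^ 2 := by
  set c := ∫ t in (0:ℝ)..1, f t with hc
  have h0 : 0 ≤ ∫ t in (0:ℝ)..1, (f t - c) ^ 2 :=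
    intervalIntegral.integral_nonneg (by norm_num) (fun t _ => sq_nonneg _)
  have h1 : ∫ t in (0:ℝ)..1, (f t - c) ^ 2
      = (∫ t in (0:ℝ)..1, f t ^ 2) - 2 * c * (∫ t in (0:ℝ)..1, f t) + c ^ 2 := by
    have e : ∀ t, (f t - c) ^ 2 = f t ^ 2 - 2 * c * f t + c ^ 2 := fun t => by ring
    simp_rw [e]
    rw [intervalIntegral.integral_add, intervalIntegral.integral_sub,
      intervalIntegral.integral_const_mul]
    · simp
    all_goals exact Continuous.intervalIntegrable (by fun_prop) _ _
  rw [h1, ← hc] at h0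
  nlinarith

lemma cs01 (f : ℝ → ℝ) (hf : Continuous f) {x x' : ℝ} (hx : x ∈ Set.Icc (0:ℝ) 1)
    (hx' : x' ∈ Set.Icc (0:ℝ) 1) :
    (∫ t in x'..x, f t) ^ 2 ≤ ∫ t in (0:ℝ)..1, f t ^ 2 := by
  have h1 : |∫ t in x'..x, f t| ≤ ∫ t in (0:ℝ)..1, |f t| := by
    have := intervalIntegral.norm_integral_le_integral_norm_uIoc (f := f) (a := x') (b := x)
      (μ := volume)
    refine this.trans ?_
    rw [intervalIntegral.integral_of_le (by norm_num)]
    refine setIntegral_mono_set ?_ (Filter.Eventually.of_forall fun t => abs_nonneg _) ?_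
    · exact (hf.abs.integrableOn_Icc (a := 0) (b := 1)).mono_set Set.Ioc_subset_Icc_self
    · refine Filter.Eventually.of_forall ?_
      intro t ht
      rcases ht with ⟨h1, h2⟩
      exact ⟨lt_of_le_of_lt (le_min hx'.1 hx.1) h1, h2.trans (max_le hx'.2 hx.2)⟩
  have h2 := jensen01 (fun t => |f t|) hf.abs
  simp only [sq_abs] at h2
  refine le_trans ?_ h2
  rw [← sq_abs]
  gcongr

lemma core (w a b : ℝ → ℝ → ℝ) (hw : Continuous (Function.uncurry w))
    (ha : Continuous (Function.uncurry a)) (hb : Continuous (Function.uncurry b))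
    (hwa : ∀ y ∈ Set.Icc (0:ℝ) 1, ∀ x ∈ Set.Icc (0:ℝ) 1, ∀ x' ∈ Set.Icc (0:ℝ) 1,
      w x y - w x' y = ∫ s in x'..x, a s y)
    (hwb : ∀ x ∈ Set.Icc (0:ℝ) 1, ∀ y ∈ Set.Icc (0:ℝ) 1, ∀ y' ∈ Set.Icc (0:ℝ) 1,
      w x y - w x y' = ∫ s in y'..y, b x s)
    (h0 : ∫ x in (0:ℝ)..1, ∫ y in (0:ℝ)..1, w x y = 0) :
    ∀ x ∈ Set.Icc (0:ℝ) 1, ∫ y in (0:ℝ)..1, w x y ^ 2 ≤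
      2 * ((∫ y in (0:ℝ)..1, ∫ x in (0:ℝ)..1, a x y ^ 2) +
        ∫ x in (0:ℝ)..1, ∫ y in (0:ℝ)..1, b x y ^ 2) := by
  intro x hx
  have hw' : ∀ x, Continuous (w x) := fun x => by
    have : w x = Function.uncurry w ∘ (fun y => (x, y)) := rfl
    rw [this]; fun_prop
  have ha' : ∀ y, Continuous (fun x => a x y) := fun y => by
    have : (fun x => a x y) = Function.uncurry a ∘ (fun x => (x, y)) := rfl
    rw [this]; fun_prop
  have hb' : ∀ x, Continuous (b x) := fun x => by
    have : b x = Function.uncurry b ∘ (fun y => (x, y)) := rfl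
    rw [this]; fun_prop
  have hA : Continuous (fun y => ∫ x in (0:ℝ)..1, a x y ^ 2) := by
    refine intervalIntegral.continuous_parametric_intervalIntegral_of_continuous' ?_ _ _
    exact (ha.comp continuous_swap).pow 2
  have hB : Continuous (fun x => ∫ y in (0:ℝ)..1, b x y ^ 2) := by
    refine intervalIntegral.continuous_parametric_intervalIntegral_of_continuous' ?_ _ _
    exact hb.pow 2
  have hM : Continuous (fun x' => ∫ y' in (0:ℝ)..1, w x' y') :=
    intervalIntegral.continuous_parametric_intervalIntegral_of_continuous' hw _ _
  set A := fun y => ∫ x in (0:ℝ)..1, a x y ^ 2 with hAdef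
  set B := fun x => ∫ y in (0:ℝ)..1, b x y ^ 2 with hBdef
  have key : ∀ y ∈ Set.Icc (0:ℝ) 1, w x y ^ 2 ≤ 2 * A y + 2 * ∫ x' in (0:ℝ)..1, B x' := by
    intro y hy
    have p1 : ∀ x' ∈ Set.Icc (0:ℝ) 1,
        (w x y - ∫ y' in (0:ℝ)..1, w x' y') ^ 2 ≤ 2 * A y + 2 * B x' := by
      intro x' hx'
      have e : w x y - ∫ y' in (0:ℝ)..1, w x' y' = ∫ y' in (0:ℝ)..1, (w x y - w x' y') := by
        rw [intervalIntegral.integral_sub (by simp) ((hw' x').intervalIntegrable _ _)]; simp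
      rw [e]
      refine (jensen01 (fun y' => w x y - w x' y') (continuous_const.sub (hw' x'))).trans ?_
      have : ∫ y' in (0:ℝ)..1, (w x y - w x' y') ^ 2 ≤ ∫ y' in (0:ℝ)..1, (2 * A y + 2 * B x') := by
        refine intervalIntegral.integral_mono_on (by norm_num) ?_ (by simp) ?_
        · exact ((continuous_const.sub (hw' x')).pow 2).intervalIntegrable _ _
        · intro y' hy'
          have q1 := cs01 (fun s => a s y) (ha' y) hx hx'
          have q2 := cs01 (b x') (hb' x') hy hy'
          rw [← hwa y hy x hx x' hx'] at q1
          rw [← hwb x' hx' y hy y' hy'] at q2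
          simp only [hAdef, hBdef]
          nlinarith [sq_nonneg ((w x y - w x' y) - (w x' y - w x' y'))]
      simpa using this
    have e : w x y = ∫ x' in (0:ℝ)..1, (w x y - ∫ y' in (0:ℝ)..1, w x' y') := by
      rw [intervalIntegral.integral_sub (by simp) (hM.intervalIntegrable _ _), h0]; simp
    calc w x y ^ 2 = (∫ x' in (0:ℝ)..1, (w x y - ∫ y' in (0:ℝ)..1, w x' y')) ^ 2 := by rw [← e]
      _ ≤ ∫ x' in (0:ℝ)..1, (w x y - ∫ y' in (0:ℝ)..1, w x' y') ^ 2 :=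
        jensen01 _ (continuous_const.sub hM)
      _ ≤ ∫ x' in (0:ℝ)..1, (2 * A y + 2 * B x') := by
        refine intervalIntegral.integral_mono_on (by norm_num) ?_ ?_ p1
        · exact ((continuous_const.sub hM).pow 2).intervalIntegrable _ _
        · exact (continuous_const.add (continuous_const.mul hB)).intervalIntegrable _ _
      _ = _ := by
        have hB2 : Continuous (fun x' => 2 * B x') := continuous_const.mul hB
        rw [intervalIntegral.integral_add (by simp) (hB2.intervalIntegrable _ _),
          intervalIntegral.integral_const_mul]; simp
  calc ∫ y in (0:ℝ)..1, w x y ^ 2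
      ≤ ∫ y in (0:ℝ)..1, (2 * A y + 2 * ∫ x' in (0:ℝ)..1, B x') := by
        refine intervalIntegral.integral_mono_on (by norm_num) ?_ ?_ key
        · exact ((hw' x).pow 2).intervalIntegrable _ _
        · exact ((continuous_const.mul hA).add continuous_const).intervalIntegrable _ _
    _ = _ := by
        have hA2 : Continuous (fun y => 2 * A y) := continuous_const.mul hA
        rw [intervalIntegral.integral_add (hA2.intervalIntegrable _ _)
          (by simp), intervalIntegral.integral_const_mul]
        simp; ring

lemma proj_le {α : Type*} [MeasurableSpace α] (μ : Measure α) (f q : α → ℝ)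
    (hff : Integrable (fun z => f z ^ 2) μ) (hqq : Integrable (fun z => q z ^ 2) μ)
    (hfq : Integrable (fun z => (f z - q z) * q z) μ)
    (h : ∫ z, (f z - q z) * q z ∂μ = 0) :
    ∫ z, q z ^ 2 ∂μ ≤ ∫ z, f z ^ 2 ∂μ := by
  have h1 : ∫ z, (q z ^ 2 + 2 * ((f z - q z) * q z)) ∂μ ≤ ∫ z, f z ^ 2 ∂μ := by
    refine integral_mono (hqq.add (hfq.const_mul 2)) hff (fun z => ?_)
    have := sq_nonneg (f z - q z)
    simp only
    nlinarith
  rwa [integral_add hqq (hfq.const_mul 2), integral_const_mul, h, mul_zero, add_zero] at h1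

lemma Ioo_int (f : ℝ → ℝ) : ∫ t in Set.Ioo (0:ℝ) 1, f t = ∫ t in (0:ℝ)..1, f t := by
  rw [intervalIntegral.integral_of_le (by norm_num), integral_Ioc_eq_integral_Ioo]

lemma Ioo_intble (f : ℝ → ℝ) (hf : Continuous f) : IntegrableOn f (Set.Ioo (0:ℝ) 1) :=
  (hf.integrableOn_Icc (a := 0) (b := 1)).mono_set Set.Ioo_subset_Icc_self

lemma sq_intble (f : ℝ × ℝ → ℝ) (hf : Continuous f) :
    IntegrableOn f (Set.Ioo (0:ℝ) 1 ×ˢ Set.Ioo (0:ℝ) 1) :=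
  (hf.continuousOn.integrableOn_compact
    ((isCompact_Icc (a := (0:ℝ)) (b := 1)).prod (isCompact_Icc (a := (0:ℝ)) (b := 1)))).mono_set
    (Set.prod_mono Set.Ioo_subset_Icc_self Set.Ioo_subset_Icc_self)

lemma sq_int (f : ℝ × ℝ → ℝ) (hf : Continuous f) :
    ∫ z in Set.Ioo (0:ℝ) 1 ×ˢ Set.Ioo (0:ℝ) 1, f z
      = ∫ x in (0:ℝ)..1, ∫ y in (0:ℝ)..1, f (x, y) := by
  have h := sq_intble f hf
  rw [Measure.volume_eq_prod] at h ⊢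
  rw [setIntegral_prod _ h, Ioo_int]
  simp_rw [Ioo_int]

lemma sq_int_swap (f : ℝ × ℝ → ℝ) (hf : Continuous f) :
    ∫ z in Set.Ioo (0:ℝ) 1 ×ˢ Set.Ioo (0:ℝ) 1, f z
      = ∫ y in (0:ℝ)..1, ∫ x in (0:ℝ)..1, f (x, y) := by
  have h := sq_intble _ (hf.comp continuous_swap)
  have h2 := sq_int _ (hf.comp continuous_swap)
  simp only [Function.comp_apply, Prod.swap_prod_mk] at h2
  rw [← h2, Measure.volume_eq_prod, ← setIntegral_prod_swap]

/-- upper stability bound for the "projected" stabilization of the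
nodal nonconforming virtual element space on the unit square, for `C¹`
functions with zero average over the square:
`Σ_e ‖Π^{0,e}_{p-1} v‖²_{0,e} + ‖Π⁰_{p-2} v‖²_{0,K} ≤ C |v|²_{1,K}`. -/
theorem stmt_7 (p : ℕ) (hp : 1 ≤ p) :
    ∃ C : ℝ, 0 < C ∧ ∀ v : ℝ × ℝ → ℝ,
      (∃ U : Set (ℝ × ℝ), IsOpen U ∧ Set.Icc ((0 : ℝ), (0 : ℝ)) (1, 1) ⊆ U ∧
        ContDiffOn ℝ 1 v U) →
      (∫ z in Set.Ioo (0 : ℝ) 1 ×ˢ Set.Ioo (0 : ℝ) 1, v z) = 0 →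
      ∀ Ve : Fin 4 → Polynomial ℝ,
        (∀ i : Fin 4, (Ve i).natDegree ≤ p - 1) →
        (∀ i : Fin 4, ∀ j ∈ Finset.range p,
          (∫ t in Set.Ioo (0 : ℝ) 1,
            (v (edgeParam i t) - (Ve i).eval t) * t ^ j) = 0) →
      ∀ vhat : MvPolynomial (Fin 2) ℝ,
        vhat ∈ polyLE ((p : ℤ) - 2) →
        (∀ m ∈ polyLE ((p : ℤ) - 2),
          (∫ z in Set.Ioo (0 : ℝ) 1 ×ˢ Set.Ioo (0 : ℝ) 1,
            (v z - evP vhat z) * evP m z) = 0) →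
      (∑ i : Fin 4, ∫ t in Set.Ioo (0 : ℝ) 1, ((Ve i).eval t) ^ 2) +
          (∫ z in Set.Ioo (0 : ℝ) 1 ×ˢ Set.Ioo (0 : ℝ) 1, (evP vhat z) ^ 2) ≤
        C * ∫ z in Set.Ioo (0 : ℝ) 1 ×ˢ Set.Ioo (0 : ℝ) 1, gradSq2 v z := by
  refine ⟨10, by norm_num, ?_⟩
  rintro v ⟨U, hU, hKU, hv⟩ hmean Ve hdeg hVe vhat hvhat hortho
  obtain ⟨pr, hprc, hprI, hprx⟩ : ∃ pr : ℝ → ℝ, Continuous pr ∧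
      (∀ x, pr x ∈ Set.Icc (0:ℝ) 1) ∧ ∀ x ∈ Set.Icc (0:ℝ) 1, pr x = x := by
    refine ⟨fun x => (Set.projIcc (0:ℝ) 1 zero_le_one x : ℝ), ?_, fun x => Subtype.prop _, ?_⟩
    · exact continuous_subtype_val.comp continuous_projIcc
    · intro x hx
      simp only [Set.projIcc_of_mem _ hx]
  have hmem : ∀ x ∈ Set.Icc (0:ℝ) 1, ∀ y ∈ Set.Icc (0:ℝ) 1, (x, y) ∈ U := fun x hx y hy =>
    hKU ⟨⟨hx.1, hy.1⟩, ⟨hx.2, hy.2⟩⟩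
  have hP : Continuous (fun z : ℝ × ℝ => (pr z.1, pr z.2)) := by fun_prop
  have hPU : ∀ z : ℝ × ℝ, (pr z.1, pr z.2) ∈ U := fun z => hmem _ (hprI _) _ (hprI _)
  have hD := hv.continuousOn_fderiv_of_isOpen hU le_rfl
  set w : ℝ → ℝ → ℝ := fun x y => v (pr x, pr y) with hwdef
  set a : ℝ → ℝ → ℝ := fun x y => fderiv ℝ v (pr x, pr y) (1, 0) with hadef
  set b : ℝ → ℝ → ℝ := fun x y => fderiv ℝ v (pr x, pr y) (0, 1) with hbdef
  have hDc : Continuous (fun z : ℝ × ℝ => fderiv ℝ v (pr z.1, pr z.2)) :=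
    hD.comp_continuous hP hPU
  have hw : Continuous (fun z : ℝ × ℝ => w z.1 z.2) := hv.continuousOn.comp_continuous hP hPU
  have ha : Continuous (fun z : ℝ × ℝ => a z.1 z.2) := hDc.clm_apply continuous_const
  have hb : Continuous (fun z : ℝ × ℝ => b z.1 z.2) := hDc.clm_apply continuous_const
  have hwv : ∀ x ∈ Set.Icc (0:ℝ) 1, ∀ y ∈ Set.Icc (0:ℝ) 1, w x y = v (x, y) := by
    intro x hx y hy
    simp only [hwdef, hprx x hx, hprx y hy]
  have hdx : ∀ x ∈ Set.Icc (0:ℝ) 1, ∀ y ∈ Set.Icc (0:ℝ) 1,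
      HasDerivAt (fun s => v (s, y)) (a x y) x := by
    intro x hx y hy
    have h1 : HasFDerivAt v (fderiv ℝ v (x, y)) (x, y) :=
      ((hv.differentiableOn one_ne_zero).differentiableAt
        (hU.mem_nhds (hmem x hx y hy))).hasFDerivAt
    simp only [hadef, hprx x hx, hprx y hy]
    exact h1.comp_hasDerivAt x ((hasDerivAt_id x).prodMk (hasDerivAt_const x y))
  have hdy : ∀ x ∈ Set.Icc (0:ℝ) 1, ∀ y ∈ Set.Icc (0:ℝ) 1,
      HasDerivAt (fun s => v (x, s)) (b x y) y := by
    intro x hx y hy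
    have h1 : HasFDerivAt v (fderiv ℝ v (x, y)) (x, y) :=
      ((hv.differentiableOn one_ne_zero).differentiableAt
        (hU.mem_nhds (hmem x hx y hy))).hasFDerivAt
    simp only [hbdef, hprx x hx, hprx y hy]
    exact h1.comp_hasDerivAt y ((hasDerivAt_const y x).prodMk (hasDerivAt_id y))
  have hsub : ∀ {x x' : ℝ}, x ∈ Set.Icc (0:ℝ) 1 → x' ∈ Set.Icc (0:ℝ) 1 →
      Set.uIcc x' x ⊆ Set.Icc (0:ℝ) 1 := fun hx hx' => Set.uIcc_subset_Icc hx' hx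
  have hwa : ∀ y ∈ Set.Icc (0:ℝ) 1, ∀ x ∈ Set.Icc (0:ℝ) 1, ∀ x' ∈ Set.Icc (0:ℝ) 1,
      w x y - w x' y = ∫ s in x'..x, a s y := by
    intro y hy x hx x' hx'
    rw [hwv x hx y hy, hwv x' hx' y hy]
    refine (intervalIntegral.integral_eq_sub_of_hasDerivAt
      (f := fun s => v (s, y)) (fun s hs => hdx s (hsub hx hx' hs) y hy) ?_).symm
    exact (ha.comp (by fun_prop : Continuous (fun s : ℝ => (s, y)))).intervalIntegrable _ _
  have hwb : ∀ x ∈ Set.Icc (0:ℝ) 1, ∀ y ∈ Set.Icc (0:ℝ) 1, ∀ y' ∈ Set.Icc (0:ℝ) 1,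
      w x y - w x y' = ∫ s in y'..y, b x s := by
    intro x hx y hy y' hy'
    rw [hwv x hx y hy, hwv x hx y' hy']
    refine (intervalIntegral.integral_eq_sub_of_hasDerivAt
      (f := fun s => v (x, s)) (fun s hs => hdy x hx s (hsub hy hy' hs)) ?_).symm
    exact (hb.comp (by fun_prop : Continuous (fun s : ℝ => (x, s)))).intervalIntegrable _ _
  have hKm : MeasurableSet (Set.Ioo (0:ℝ) 1 ×ˢ Set.Ioo (0:ℝ) 1) :=
    measurableSet_Ioo.prod measurableSet_Ioo
  have hI : ∀ {t : ℝ}, t ∈ Set.Ioo (0:ℝ) 1 → t ∈ Set.Icc (0:ℝ) 1 :=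
    fun h => Set.Ioo_subset_Icc_self h
  have hKv : ∀ z ∈ Set.Ioo (0:ℝ) 1 ×ˢ Set.Ioo (0:ℝ) 1, v z = w z.1 z.2 := fun z hz =>
    (hwv z.1 (hI hz.1) z.2 (hI hz.2)).symm
  rw [setIntegral_congr_fun hKm hKv] at hmean
  have hG : ∫ z in Set.Ioo (0 : ℝ) 1 ×ˢ Set.Ioo (0 : ℝ) 1, gradSq2 v z
      = (∫ y in (0:ℝ)..1, ∫ x in (0:ℝ)..1, a x y ^ 2) +
        ∫ x in (0:ℝ)..1, ∫ y in (0:ℝ)..1, b x y ^ 2 := by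
    have e : ∀ z ∈ Set.Ioo (0:ℝ) 1 ×ˢ Set.Ioo (0:ℝ) 1,
        gradSq2 v z = a z.1 z.2 ^ 2 + b z.1 z.2 ^ 2 := by
      intro z hz
      simp only [gradSq2]
      rw [(hdx z.1 (hI hz.1) z.2 (hI hz.2)).deriv, (hdy z.1 (hI hz.1) z.2 (hI hz.2)).deriv]
    have ha2 : Continuous (fun z : ℝ × ℝ => a z.1 z.2 ^ 2) := ha.pow 2
    have hb2 : Continuous (fun z : ℝ × ℝ => b z.1 z.2 ^ 2) := hb.pow 2
    rw [setIntegral_congr_fun hKm e, integral_add (sq_intble _ ha2) (sq_intble _ hb2),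
      sq_int_swap _ ha2, sq_int _ hb2]
  have cV := core w a b hw ha hb hwa hwb (by rw [← sq_int _ hw]; exact hmean)
  have cH := core (fun y x => w x y) (fun y x => b x y) (fun y x => a x y)
    (hw.comp continuous_swap) (hb.comp continuous_swap) (ha.comp continuous_swap)
    hwb hwa (by rw [← sq_int_swap _ hw]; exact hmean)
  rw [hG]
  set G := (∫ y in (0:ℝ)..1, ∫ x in (0:ℝ)..1, a x y ^ 2) +
        ∫ x in (0:ℝ)..1, ∫ y in (0:ℝ)..1, b x y ^ 2 with hGdef
  rw [add_comm, ← hGdef] at cH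
  have h0I : (0:ℝ) ∈ Set.Icc (0:ℝ) 1 := by simp
  have h1I : (1:ℝ) ∈ Set.Icc (0:ℝ) 1 := by simp
  -- edges
  have edge : ∀ i, ∫ t in Set.Ioo (0 : ℝ) 1, ((Ve i).eval t) ^ 2 ≤ 2 * G := by
    intro i
    have hf : Continuous (fun t : ℝ => w (edgeParam i t).1 (edgeParam i t).2) := by
      refine hw.comp ?_
      fin_cases i <;> simp only [edgeParam] <;> fun_prop
    have hfv : ∀ t ∈ Set.Ioo (0:ℝ) 1,
        v (edgeParam i t) = w (edgeParam i t).1 (edgeParam i t).2 := by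
      intro t ht
      symm
      fin_cases i
      · exact hwv t (hI ht) 0 h0I
      · exact hwv 1 h1I t (hI ht)
      · exact hwv t (hI ht) 1 h1I
      · exact hwv 0 h0I t (hI ht)
    have hbd : ∫ t in Set.Ioo (0:ℝ) 1, w (edgeParam i t).1 (edgeParam i t).2 ^ 2 ≤ 2 * G := by
      rw [Ioo_int]
      fin_cases i
      · exact cH 0 h0I
      · exact cV 1 h1I
      · exact cH 1 h1I
      · exact cV 0 h0I
    set f : ℝ → ℝ := fun t => w (edgeParam i t).1 (edgeParam i t).2 with hfdef
    have hq : Continuous (fun t => (Ve i).eval t) := (Ve i).continuous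
    refine le_trans (proj_le _ f _ (Ioo_intble _ (hf.pow 2)) (Ioo_intble _ (hq.pow 2))
      (Ioo_intble _ ((hf.sub hq).mul hq)) ?_) hbd
    have e : ∀ t, (f t - (Ve i).eval t) * (Ve i).eval t
        = ∑ j ∈ Finset.range p, (Ve i).coeff j * ((f t - (Ve i).eval t) * t ^ j) := by
      intro t
      have hlt : (Ve i).natDegree < p := by have := hdeg i; omega
      conv_lhs => rw [mul_comm, Polynomial.eval_eq_sum_range' hlt t, Finset.sum_mul]
      rw [← Polynomial.eval_eq_sum_range' hlt t]
      exact Finset.sum_congr rfl fun j _ => by ring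
    simp_rw [e]
    rw [integral_finsetSum]
    · refine Finset.sum_eq_zero fun j hj => ?_
      rw [integral_const_mul, ← setIntegral_congr_fun (f := fun t =>
        (v (edgeParam i t) - (Ve i).eval t) * t ^ j) measurableSet_Ioo, hVe i j hj, mul_zero]
      intro t ht
      simp only [hfv t ht, hfdef]
    · intro j _
      exact Ioo_intble _ (continuous_const.mul ((hf.sub hq).mul (continuous_pow j)))
  have bulk : ∫ z in Set.Ioo (0 : ℝ) 1 ×ˢ Set.Ioo (0 : ℝ) 1, (evP vhat z) ^ 2 ≤ 2 * G := by
    have hq : Continuous (evP vhat) := by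
      unfold evP
      refine (MvPolynomial.continuous_eval vhat).comp ?_
      refine continuous_pi fun i => ?_
      fin_cases i
      · exact continuous_fst
      · exact continuous_snd
    refine le_trans (proj_le _ (fun z => w z.1 z.2) _ (sq_intble _ (hw.pow 2))
      (sq_intble _ (hq.pow 2)) (sq_intble _ ((hw.sub hq).mul hq)) ?_) ?_
    · refine Eq.trans ?_ (hortho vhat hvhat)
      refine setIntegral_congr_fun hKm fun z hz => ?_
      simp only [hKv z hz]
    · have hw2 : Continuous (fun z : ℝ × ℝ => w z.1 z.2 ^ 2) := hw.pow 2
      rw [sq_int _ hw2]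
      have : ∫ x in (0:ℝ)..1, ∫ y in (0:ℝ)..1, w x y ^ 2 ≤ ∫ x in (0:ℝ)..1, 2 * G := by
        refine intervalIntegral.integral_mono_on (by norm_num) ?_ (by simp) cV
        refine Continuous.intervalIntegrable ?_ _ _
        exact intervalIntegral.continuous_parametric_intervalIntegral_of_continuous'
          (hw.pow 2) _ _
      simpa using this
  have hs := Finset.sum_le_sum (fun i (_ : i ∈ Finset.univ) => edge i)
  rw [Finset.sum_const, Finset.card_univ, Fintype.card_fin, nsmul_eq_mul] at hs
  push_cast at hs
  linarith
end
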